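/- Let 0<s<1/2 and let m ≥ 0 be an integer. Then ∫_0^∞ e^{−2t} I_m(2t) t^{s−1} dt = 4^{−s} Γ(1/2−s) Γ(m+s) / (√π Γ(m+1−s)), where I_m is the modified Bessel function of the first kind of integer order m, defined by the everywhere-convergent power series I_m(x) = ∑_{k=0}^{∞} (x/2)^{2k+m} / (k! (k+m)!). -/

import Mathlib

open Real MeasureTheory

/-- The modified Bessel function of the first kind of integer order `m ≥ 0`,
defined by its everywhere-convergent power series. -/
noncomputable def besselI (m : ℕ) (x : ℝ) : ℝ :=
  ∑' k : ℕ, (x / 2) ^ (2 * k + m) / ((k.factorial : ℝ) * ((k + m).factorial : ℝ))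
open Set

/-- Monotone convergence for series of nonnegative functions whose sum is integrable. -/
theorem hasSum_integral_of_nonneg_of_integrable {α : Type*} [MeasurableSpace α] {μ : Measure α}
    {f : ℕ → α → ℝ} {F : α → ℝ} (hf : ∀ k, AEStronglyMeasurable (f k) μ)
    (hf0 : ∀ k, ∀ᵐ x ∂μ, 0 ≤ f k x) (hF : Integrable F μ)
    (hsum : ∀ᵐ x ∂μ, HasSum (fun k ↦ f k x) (F x)) :
    HasSum (fun k ↦ ∫ x, f k x ∂μ) (∫ x, F x ∂μ) := by
  refine hasSum_integral_of_dominated_convergence f hf (fun k ↦ ?_)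
    (hsum.mono fun x hx ↦ hx.summable) ?_ hsum
  · filter_upwards [hf0 k] with x hx
    rw [Real.norm_of_nonneg hx]
  · exact hF.congr (hsum.mono fun x hx ↦ hx.tsum_eq.symm)

theorem integral_eq_of_hasSum_of_nonneg {α : Type*} [MeasurableSpace α] {μ : Measure α}
    {f : ℕ → α → ℝ} {F : α → ℝ} {S : ℝ} (hf : ∀ k, Integrable (f k) μ)
    (hf0 : ∀ k, ∀ᵐ x ∂μ, 0 ≤ f k x) (hS : HasSum (fun k ↦ ∫ x, f k x ∂μ) S)
    (hsum : ∀ᵐ x ∂μ, HasSum (fun k ↦ f k x) (F x)) :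
    ∫ x, F x ∂μ = S := by
  have hnorm : ∀ k, ∫ x, ‖f k x‖ ∂μ = ∫ x, f k x ∂μ := fun k ↦
    integral_congr_ae ((hf0 k).mono fun x hx ↦ Real.norm_of_nonneg hx)
  have h := hasSum_integral_of_summable_integral_norm hf (by simpa only [hnorm] using hS.summable)
  rw [← h.unique hS]
  exact integral_congr_ae (hsum.mono fun x hx ↦ hx.tsum_eq.symm)

theorem integrableOn_rpow_sub_one_mul_exp_neg_mul {a r : ℝ} (ha : 0 < a) (hr : 0 < r) :
    IntegrableOn (fun t : ℝ ↦ t ^ (a - 1) * exp (-(r * t))) (Ioi 0) := by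
  have h := integrableOn_rpow_mul_exp_neg_mul_rpow (p := 1) (s := a - 1) (b := r)
    (by linarith) one_pos hr
  simpa only [rpow_one, neg_mul] using h

/-- The binomial series of `(1 - x) ^ (-a)`. -/
theorem hasSum_Gamma_mul_pow_div_factorial {a x : ℝ} (ha : 0 < a) (hx0 : 0 ≤ x) (hx1 : x < 1) :
    HasSum (fun k : ℕ ↦ Gamma (k + a) * x ^ k / k.factorial) (Gamma a * (1 - x) ^ (-a)) := by
  have h := hasSum_integral_of_nonneg_of_integrable (μ := volume.restrict (Ioi (0 : ℝ)))
    (f := fun k t ↦ x ^ k / k.factorial * (t ^ ((k + a : ℝ) - 1) * exp (-(1 * t))))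
    (F := fun t ↦ t ^ (a - 1) * exp (-((1 - x) * t))) (fun k ↦ ?_) (fun k ↦ ?_)
    (integrableOn_rpow_sub_one_mul_exp_neg_mul ha (by linarith)) ?_
  · simp only [integral_const_mul] at h
    rw [integral_rpow_mul_exp_neg_mul_Ioi ha (by linarith)] at h
    convert! h using 1
    · ext k
      rw [integral_rpow_mul_exp_neg_mul_Ioi (by positivity) one_pos]
      simp
      ring
    · rw [rpow_neg (by linarith), one_div, inv_rpow (by linarith), mul_comm]
  · exact ((integrableOn_rpow_sub_one_mul_exp_neg_mul (by positivity) one_pos).const_mul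
      _).aestronglyMeasurable
  · filter_upwards [ae_restrict_mem measurableSet_Ioi] with t (ht : 0 < t)
    positivity
  · filter_upwards [ae_restrict_mem measurableSet_Ioi] with t (ht : 0 < t)
    have h := (NormedSpace.expSeries_div_hasSum_exp (x * t)).mul_left
      (t ^ (a - 1) * exp (-(1 * t)))
    rw [← Real.exp_eq_exp_ℝ, mul_assoc, ← Real.exp_add] at h
    convert! h using 1
    · ext k
      rw [add_sub_assoc, rpow_add ht, rpow_natCast, mul_pow]
      ring
    · ring_nf

theorem integrableOn_and_integral_rpow_mul_one_sub_rpow {a b : ℝ} (ha : 0 < a) (hb : 0 < b) :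
    IntegrableOn (fun x : ℝ ↦ x ^ (a - 1) * (1 - x) ^ (b - 1)) (Ioo 0 1) ∧
      ∫ x in Ioo (0 : ℝ) 1, x ^ (a - 1) * (1 - x) ^ (b - 1) =
        Gamma a * Gamma b / Gamma (a + b) := by
  have hβ := ProbabilityTheory.beta_pos ha hb
  have h := ProbabilityTheory.lintegral_betaPDF_eq_one ha hb
  rw [ProbabilityTheory.lintegral_betaPDF] at h
  have hm : Measurable
      (fun x : ℝ ↦ 1 / ProbabilityTheory.beta a b * x ^ (a - 1) * (1 - x) ^ (b - 1)) := by
    fun_prop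
  have h0 : 0 ≤ᵐ[volume.restrict (Ioo (0 : ℝ) 1)]
      (fun x : ℝ ↦ 1 / ProbabilityTheory.beta a b * x ^ (a - 1) * (1 - x) ^ (b - 1)) := by
    filter_upwards [ae_restrict_mem measurableSet_Ioo] with x ⟨hx0, hx1⟩
    have : 0 < 1 - x := by linarith
    simp only [Pi.zero_apply]
    positivity
  have hint := (lintegral_ofReal_ne_top_iff_integrable hm.aestronglyMeasurable h0).1
    (h.trans_ne ENNReal.one_ne_top)
  have hval := integral_eq_lintegral_of_nonneg_ae h0 hm.aestronglyMeasurable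
  rw [h, ENNReal.toReal_one] at hval
  simp only [mul_assoc] at hint hval
  rw [integral_const_mul] at hval
  constructor
  · refine (hint.const_mul (ProbabilityTheory.beta a b)).congr (ae_of_all _ fun x ↦ ?_)
    field_simp
  · change _ = ProbabilityTheory.beta a b
    field_simp at hval
    exact hval

/-- Gauss's summation theorem for `₂F₁(a, b; c; 1)`. -/
theorem hasSum_Gauss {a b c : ℝ} (ha : 0 < a) (hb : 0 < b) (hc : a + b < c) :
    HasSum (fun k : ℕ ↦ Gamma (k + a) * Gamma (k + b) / (k.factorial * Gamma (k + c)))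
      (Gamma a * Gamma b * Gamma (c - a - b) / (Gamma (c - a) * Gamma (c - b))) := by
  have hcb : 0 < c - b := by linarith
  have hG : 0 < Gamma (c - b) := Gamma_pos_of_pos hcb
  have hbeta := integrableOn_and_integral_rpow_mul_one_sub_rpow hb
    (show 0 < c - a - b by linarith)
  have hk := fun k : ℕ ↦ integrableOn_and_integral_rpow_mul_one_sub_rpow
    (show 0 < (k + b : ℝ) by positivity) hcb
  have h := hasSum_integral_of_nonneg_of_integrable (μ := volume.restrict (Ioo (0 : ℝ) 1))
    (f := fun k x ↦ Gamma (k + a) / k.factorial *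
      (x ^ ((k + b : ℝ) - 1) * (1 - x) ^ (c - b - 1)))
    (F := fun x ↦ Gamma a * (x ^ (b - 1) * (1 - x) ^ (c - a - b - 1)))
    (fun k ↦ ((hk k).1.const_mul _).aestronglyMeasurable) (fun k ↦ ?_)
    (hbeta.1.const_mul _) ?_
  · simp only [integral_const_mul] at h
    rw [hbeta.2] at h
    convert! h.div_const (Gamma (c - b)) using 1
    · ext k
      rw [(hk k).2, show (k + b + (c - b) : ℝ) = k + c by ring]
      field_simp
    · rw [show b + (c - a - b) = c - a by ring]
      field_simp
  · filter_upwards [ae_restrict_mem measurableSet_Ioo] with x ⟨hx0, hx1⟩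
    have : 0 < 1 - x := by linarith
    have : 0 < Gamma (k + a) := Gamma_pos_of_pos (by positivity)
    positivity
  · filter_upwards [ae_restrict_mem measurableSet_Ioo] with x ⟨hx0, hx1⟩
    have h := (hasSum_Gamma_mul_pow_div_factorial ha hx0.le hx1).mul_left
      (x ^ (b - 1) * (1 - x) ^ (c - b - 1))
    convert! h using 1
    · ext k
      rw [add_sub_assoc, rpow_add hx0, rpow_natCast]
      ring
    · rw [show c - a - b - 1 = (c - b - 1) + (-a) by ring, rpow_add (by linarith)]
      ring

theorem hasSum_besselI (m : ℕ) {x : ℝ} (hx : 0 ≤ x) :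
    HasSum (fun k : ℕ ↦ (x / 2) ^ (2 * k + m) / ((k.factorial : ℝ) * ((k + m).factorial : ℝ)))
      (besselI m x) := by
  refine Summable.hasSum (Summable.of_nonneg_of_le (fun k ↦ by positivity) (fun k ↦ ?_)
    ((NormedSpace.expSeries_div_summable ((x / 2) ^ 2)).mul_left ((x / 2) ^ m)))
  rw [pow_add, pow_mul, mul_comm, ← mul_div_assoc]
  refine div_le_div_of_nonneg_left (by positivity) (by positivity) ?_
  exact le_mul_of_one_le_right (by positivity) (by exact_mod_cast Nat.factorial_pos (k + m))

theorem bessel_integral_fracInt (s : ℝ) (hs0 : 0 < s) (hs1 : s < 1 / 2) (m : ℕ) :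
    ∫ t in Set.Ioi (0 : ℝ), Real.exp (-2 * t) * besselI m (2 * t) * t ^ (s - 1) =
      4 ^ (-s) * Real.Gamma (1 / 2 - s) * Real.Gamma ((m : ℝ) + s) /
        (Real.sqrt Real.pi * Real.Gamma ((m : ℝ) + 1 - s)) := by
  have hint := fun k : ℕ ↦ integrableOn_rpow_sub_one_mul_exp_neg_mul
    (show (0 : ℝ) < 2 * k + m + s by positivity) two_pos
  refine integral_eq_of_hasSum_of_nonneg
    (f := fun k t ↦ 1 / ((k.factorial : ℝ) * ((k + m).factorial : ℝ)) *
      (t ^ ((2 * k + m + s : ℝ) - 1) * exp (-(2 * t))))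
    (fun k ↦ (hint k).const_mul _) (fun k ↦ ?_) ?_ ?_
  · filter_upwards [ae_restrict_mem measurableSet_Ioi] with t (ht : 0 < t)
    positivity
  · have hG : 0 < Gamma (m + 1 - s) := Gamma_pos_of_pos (by linarith)
    have h := (hasSum_Gauss (a := (m + s) / 2) (b := (m + s) / 2 + 1 / 2) (c := m + 1)
      (by positivity) (by positivity) (by linarith)).mul_left (1 / (2 * √π))
    convert! h using 1
    · ext k
      have hdup := Gamma_mul_Gamma_add_half (k + (m + s) / 2)
      rw [show 2 * (k + (m + s) / 2) = 2 * k + m + s by ring] at hdup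
      rw [integral_const_mul, integral_rpow_mul_exp_neg_mul_Ioi (by positivity) two_pos,
        ← add_assoc (k : ℝ), ← add_assoc (k : ℝ), ← Nat.cast_add, Gamma_nat_eq_factorial, hdup,
        rpow_sub two_pos, rpow_one, one_div 2, inv_rpow two_pos.le]
      field_simp
    · have h1 := Gamma_mul_Gamma_add_half ((m + s) / 2)
      have h2 := Gamma_mul_Gamma_add_half ((m + 1 - s) / 2)
      rw [show 2 * ((m + s) / 2) = m + s by ring] at h1
      rw [show 2 * ((m + 1 - s) / 2) = m + 1 - s by ring] at h2
      rw [show (m + 1 - (m + s) / 2 : ℝ) = (m + 1 - s) / 2 + 1 / 2 by ring,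
        show (m + 1 - ((m + s) / 2 + 1 / 2) : ℝ) = (m + 1 - s) / 2 by ring,
        show ((m + 1 - s) / 2 + 1 / 2 - ((m + s) / 2 + 1 / 2) : ℝ) = 1 / 2 - s by ring,
        h1, mul_comm (Gamma ((m + 1 - s) / 2 + 1 / 2)), h2]
      have h4 : (4 : ℝ) ^ (-s) * 2 * 2 ^ (1 - (m + 1 - s)) = 2 ^ (1 - (m + s)) := by
        rw [show (4 : ℝ) = 2 ^ (2 : ℝ) by norm_num, ← rpow_mul two_pos.le,
          ← rpow_add_one two_ne_zero, ← rpow_add two_pos]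
        ring_nf
      rw [← h4]
      field_simp
  · filter_upwards [ae_restrict_mem measurableSet_Ioi] with t (ht : 0 < t)
    have h := ((hasSum_besselI m (show 0 ≤ 2 * t by positivity)).mul_left
      (exp (-2 * t))).mul_right (t ^ (s - 1))
    convert! h using 1
    ext k
    rw [add_sub_assoc, rpow_add ht, show (2 * k + m : ℝ) = ((2 * k + m : ℕ) : ℝ) by push_cast; rfl,
      rpow_natCast, mul_div_cancel_left₀ t two_ne_zero, neg_mul]
    ring
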